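/- arXiv:1912.10394 — 4 statements merged into one kernel-verified Lean document; each statement's English description precedes it below -/
import Mathlib

section
/- Let n, p be positive natural numbers, let G be a real n × n matrix, C a real p × n matrix, P a symmetric positive definite real n × n matrix such that P G + Gᵀ P is negative definite, θ a symmetric positive semidefinite real p × p matrix, and α > 0. Define N := -α P⁻¹ Cᵀ θ. Then the only vector v ∈ ℝⁿ satisfying G v + ((C v)ᵀ θ (C v)) • (N (C v)) = 0 is v = 0. -/
open Matrix

/-- The symmetrized quadratic form of `P * G` is twice that of `P * G`. -/
lemma dotProduct_mul_add_transpose_mul_mulVec {ι R : Type*} [Fintype ι] [CommRing R]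
    {P : Matrix ι ι R} (hP : Pᵀ = P) (G : Matrix ι ι R) (v : ι → R) :
    v ⬝ᵥ (P * G + Gᵀ * P) *ᵥ v = 2 * (v ⬝ᵥ P *ᵥ (G *ᵥ v)) := by
  have hsymm : v ⬝ᵥ (Gᵀ * P) *ᵥ v = v ⬝ᵥ (P * G) *ᵥ v := by
    rw [dotProduct_mulVec, ← mulVec_transpose, dotProduct_comm, transpose_mul,
      transpose_transpose, hP]
  rw [add_mulVec, dotProduct_add, hsymm, ← mulVec_mulVec, two_mul]

/-- Theorem 3 of the paper, second half: with `N = -α P⁻¹ Cᵀ θ` and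
`P G + Gᵀ P` negative definite, the cubic error dynamics
`G v + (vᵀCᵀ θ C v) • N C v` has no equilibrium other than the origin. -/
theorem cubic_observer_no_nonzero_equilibrium
    (n p : ℕ) (hn : 0 < n) (hp : 0 < p)
    (G : Matrix (Fin n) (Fin n) ℝ) (C : Matrix (Fin p) (Fin n) ℝ)
    (P : Matrix (Fin n) (Fin n) ℝ) (hP : P.PosDef)
    (hPG : ∀ v : Fin n → ℝ, v ≠ 0 → v ⬝ᵥ (P * G + Gᵀ * P) *ᵥ v < 0)
    (θ : Matrix (Fin p) (Fin p) ℝ) (hθ : θ.PosSemidef)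
    (α : ℝ) (hα : 0 < α)
    (N : Matrix (Fin n) (Fin p) ℝ) (hN : N = (-α) • (P⁻¹ * Cᵀ * θ))
    (v : Fin n → ℝ)
    (hv : G *ᵥ v + ((C *ᵥ v) ⬝ᵥ θ *ᵥ (C *ᵥ v)) • (N *ᵥ (C *ᵥ v)) = 0) :
    v = 0 := by
  by_contra hv0
  have hPt : Pᵀ = P := by simpa using hP.isHermitian.eq
  have hPN : P * N = (-α) • (Cᵀ * θ) := by
    rw [hN, Matrix.mul_smul, Matrix.mul_assoc,
      mul_nonsing_inv_cancel_left P _ ((isUnit_iff_isUnit_det P).mp hP.isUnit)]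
  have hquad : v ⬝ᵥ P *ᵥ (N *ᵥ (C *ᵥ v)) = -α * ((C *ᵥ v) ⬝ᵥ θ *ᵥ (C *ᵥ v)) := by
    rw [mulVec_mulVec, hPN, smul_mulVec, dotProduct_smul, smul_eq_mul, ← mulVec_mulVec,
      dotProduct_mulVec v, vecMul_transpose]
  have hvP := congrArg (fun w => v ⬝ᵥ P *ᵥ w) hv
  simp only [mulVec_add, mulVec_smul, dotProduct_add, dotProduct_smul, smul_eq_mul, mulVec_zero,
    dotProduct_zero, hquad] at hvP
  have hneg := hPG v hv0
  rw [dotProduct_mul_add_transpose_mul_mulVec hPt] at hneg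
  nlinarith [mul_nonneg hα.le (sq_nonneg ((C *ᵥ v) ⬝ᵥ θ *ᵥ (C *ᵥ v)))]
end

section
/- Let n, p, q be positive natural numbers and let A, G be real n × n matrices, C a real p × n matrix, D a real n × q matrix, E, J, N real n × p matrices, and θ a real p × p matrix. Assume the matrix equations (I - E C) A - J C - G (I - E C) = 0 and (I - E C) D = 0 hold. Let f_u : ℝ → ℝⁿ, f_g : ℝ → ℝ^q, and f_L : ℝ → ℝⁿ → ℝⁿ be functions, and let x, w : ℝ → ℝⁿ be differentiable functions satisfying, for all t, x'(t) = A x(t) + f_u(t) + D f_g(t) + f_L(t)(x(t)) and w'(t) = G w(t) + J (C x(t)) + (I - E C) f_u(t) + (I - E C) f_L(t)(x̂(t)) - ((C e(t))ᵀ θ (C e(t))) • (N (C e(t))), where x̂(t) := w(t) + E (C x(t)) and e(t) := x(t) - x̂(t). Then for all t, e is differentiable at t with e'(t) = G e(t) + (I - E C)(f_L(t)(x(t)) - f_L(t)(x̂(t))) + ((C e(t))ᵀ θ (C e(t))) • (N (C e(t))). -/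
open Matrix

/-- Derivation of the estimation error dynamics (equation (11)) in the proof of
Theorem 1: under the decoupling conditions (9) and (10), the error `e = x - xhat`
of the cubic observer obeys a dynamics independent of `x`, `f_u` and `f_g`. -/
theorem cubic_observer_error_dynamics
    (n p q : ℕ) (hn : 0 < n) (hp : 0 < p) (hq : 0 < q)
    (A G : Matrix (Fin n) (Fin n) ℝ) (C : Matrix (Fin p) (Fin n) ℝ)
    (D : Matrix (Fin n) (Fin q) ℝ) (E J N : Matrix (Fin n) (Fin p) ℝ)
    (θ : Matrix (Fin p) (Fin p) ℝ)
    (h9 : (1 - E * C) * A - J * C - G * (1 - E * C) = 0)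
    (h10 : (1 - E * C) * D = 0)
    (fu : ℝ → Fin n → ℝ) (fg : ℝ → Fin q → ℝ)
    (fL : ℝ → (Fin n → ℝ) → Fin n → ℝ)
    (x w : ℝ → Fin n → ℝ)
    (xhat : ℝ → Fin n → ℝ) (hxhat : ∀ t, xhat t = w t + E *ᵥ (C *ᵥ x t))
    (e : ℝ → Fin n → ℝ) (he : ∀ t, e t = x t - xhat t)
    (hx : ∀ t, HasDerivAt x (A *ᵥ x t + fu t + D *ᵥ fg t + fL t (x t)) t)
    (hw : ∀ t, HasDerivAt w
      (G *ᵥ w t + J *ᵥ (C *ᵥ x t) + (1 - E * C) *ᵥ fu t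
        + (1 - E * C) *ᵥ fL t (xhat t)
        - ((C *ᵥ e t) ⬝ᵥ θ *ᵥ (C *ᵥ e t)) • (N *ᵥ (C *ᵥ e t))) t) :
    ∀ t, HasDerivAt e
      (G *ᵥ e t + (1 - E * C) *ᵥ (fL t (x t) - fL t (xhat t))
        + ((C *ᵥ e t) ⬝ᵥ θ *ᵥ (C *ᵥ e t)) • (N *ᵥ (C *ᵥ e t))) t := by
  intro t
  have hew : e = fun s => (1 - E * C) *ᵥ x s - w s := by
    funext s
    rw [he, hxhat, sub_mulVec, one_mulVec, mulVec_mulVec]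
    abel
  have hMx := (LinearMap.toContinuousLinearMap
    (mulVecLin (1 - E * C))).hasFDerivAt.comp_hasDerivAt t (hx t)
  refine ((hMx.sub (hw t)).congr_of_eventuallyEq (.of_eq hew)).congr_deriv ?_
  have hw_eq : w t = (1 - E * C) *ᵥ x t - e t := by simp [hew]
  have hAx : (1 - E * C) *ᵥ (A *ᵥ x t)
      = J *ᵥ (C *ᵥ x t) + G *ᵥ ((1 - E * C) *ᵥ x t) := by
    simp only [mulVec_mulVec, ← add_mulVec]
    rw [← sub_eq_zero.mp ((sub_sub _ _ _).symm.trans h9)]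
  have hDf : (1 - E * C) *ᵥ (D *ᵥ fg t) = 0 := by
    rw [mulVec_mulVec, h10, zero_mulVec]
  rw [LinearMap.coe_toContinuousLinearMap', mulVecLin_apply, hw_eq]
  generalize 1 - E * C = M at *
  simp only [mulVec_add, mulVec_sub, hAx, hDf]
  abel
end

section
/- Let n, p be positive natural numbers, let G be a real n × n matrix, C a real p × n matrix, E, N real n × p matrices, θ a symmetric positive semidefinite real p × p matrix, P a symmetric positive definite real n × n matrix, and β > 0, γ > 0 real numbers. Assume: (i) for all vectors e, Δ ∈ ℝⁿ not both zero, eᵀ (P G + Gᵀ P) e + γ² β ‖e‖² + 2 eᵀ P (I - E C) Δ - β ‖Δ‖² < 0; and (ii) P N C + Cᵀ Nᵀ P is negative definite. Then for every e ∈ ℝⁿ with e ≠ 0 and every Δ ∈ ℝⁿ with ‖Δ‖ ≤ γ ‖e‖, one has eᵀ (P G + Gᵀ P) e + ((C e)ᵀ θ (C e)) · (eᵀ (P N C + Cᵀ Nᵀ P) e) + 2 eᵀ P (I - E C) Δ < 0. -/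
open Matrix

/-- Core pointwise inequality in the proof of Theorem 1: under the scalar form
of the LMI (7) and negative definiteness of `PNC + CᵀNᵀP`, the Lyapunov
derivative is strictly negative for every nonzero error `e` and every
increment `Δ` of a `γ`-Lipschitz nonlinearity. -/
theorem cubic_observer_lyapunov_negative_lipschitz
    (n p : ℕ) (hn : 0 < n) (hp : 0 < p)
    (G : Matrix (Fin n) (Fin n) ℝ) (C : Matrix (Fin p) (Fin n) ℝ)
    (E N : Matrix (Fin n) (Fin p) ℝ)
    (θ : Matrix (Fin p) (Fin p) ℝ) (hθ : θ.PosSemidef)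
    (P : Matrix (Fin n) (Fin n) ℝ) (hP : P.PosDef)
    (β γ : ℝ) (hβ : 0 < β) (hγ : 0 < γ)
    (h1 : ∀ e Δ : EuclideanSpace ℝ (Fin n), ¬(e = 0 ∧ Δ = 0) →
      e ⬝ᵥ (P * G + Gᵀ * P) *ᵥ e + γ ^ 2 * β * ‖e‖ ^ 2
        + 2 * (e ⬝ᵥ (P * (1 - E * C)) *ᵥ Δ) - β * ‖Δ‖ ^ 2 < 0)
    (h2 : ∀ v : Fin n → ℝ, v ≠ 0 →
      v ⬝ᵥ (P * N * C + Cᵀ * Nᵀ * P) *ᵥ v < 0) :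
    ∀ e : EuclideanSpace ℝ (Fin n), e ≠ 0 →
      ∀ Δ : EuclideanSpace ℝ (Fin n), ‖Δ‖ ≤ γ * ‖e‖ →
        e ⬝ᵥ (P * G + Gᵀ * P) *ᵥ e
          + ((C *ᵥ e) ⬝ᵥ θ *ᵥ (C *ᵥ e)) * (e ⬝ᵥ (P * N * C + Cᵀ * Nᵀ * P) *ᵥ e)
          + 2 * (e ⬝ᵥ (P * (1 - E * C)) *ᵥ Δ) < 0 := by
  intro e he Δ hΔ
  have hLMI := h1 e Δ fun h => he h.1
  have hneg : e ⬝ᵥ (P * N * C + Cᵀ * Nᵀ * P) *ᵥ e < 0 :=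
    h2 e fun h => he (WithLp.ofLp_injective 2 h)
  have hnonneg : 0 ≤ (C *ᵥ e) ⬝ᵥ θ *ᵥ (C *ᵥ e) := by
    simpa using hθ.dotProduct_mulVec_nonneg (C *ᵥ e)
  have hcubic := mul_nonpos_of_nonneg_of_nonpos hnonneg hneg.le
  have hsq : β * ‖Δ‖ ^ 2 ≤ β * (γ * ‖e‖) ^ 2 := by gcongr
  rw [mul_pow] at hsq
  linarith
end

section
/- Let n, p be positive natural numbers, let G be a real n × n matrix, C a real p × n matrix, E, N real n × p matrices, θ a symmetric positive semidefinite real p × p matrix, P a symmetric positive definite real n × n matrix, ρ, a, b real numbers, and μ₁ > 0, μ₂ > 0 real numbers. Assume: (i) for all vectors e, Δ ∈ ℝⁿ not both zero, eᵀ (P G + Gᵀ P) e + 2(μ₁ ρ + μ₂ a) ‖e‖² + 2 eᵀ P (I - E C) Δ + 2(μ₂ b - μ₁) ⟨Δ, e⟩ - 2 μ₂ ‖Δ‖² < 0; and (ii) P N C + Cᵀ Nᵀ P is negative definite. Then for every e ∈ ℝⁿ with e ≠ 0 and every Δ ∈ ℝⁿ satisfying ⟨Δ, e⟩ ≤ ρ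 ‖e‖² and ‖Δ‖² ≤ a ‖e‖² + b ⟨Δ, e⟩, one has eᵀ (P G + Gᵀ P) e + ((C e)ᵀ θ (C e)) · (eᵀ (P N C + Cᵀ Nᵀ P) e) + 2 eᵀ P (I - E C) Δ < 0. -/
open Matrix
open scoped RealInnerProductSpace

/-- Core pointwise inequality in the proof of Theorem 2: under the scalar form
of the LMI (17) and negative definiteness of `PNC + CᵀNᵀP`, the Lyapunov
derivative is strictly negative for every nonzero error `e` and every
increment `Δ` of a one-sided Lipschitz, quadratically inner-bounded
nonlinearity. -/
theorem cubic_observer_lyapunov_negative_osl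
    (n p : ℕ) (hn : 0 < n) (hp : 0 < p)
    (G : Matrix (Fin n) (Fin n) ℝ) (C : Matrix (Fin p) (Fin n) ℝ)
    (E N : Matrix (Fin n) (Fin p) ℝ)
    (θ : Matrix (Fin p) (Fin p) ℝ) (hθ : θ.PosSemidef)
    (P : Matrix (Fin n) (Fin n) ℝ) (hP : P.PosDef)
    (ρ a b : ℝ) (μ₁ μ₂ : ℝ) (hμ₁ : 0 < μ₁) (hμ₂ : 0 < μ₂)
    (h1 : ∀ e Δ : EuclideanSpace ℝ (Fin n), ¬(e = 0 ∧ Δ = 0) →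
      e ⬝ᵥ (P * G + Gᵀ * P) *ᵥ e + 2 * (μ₁ * ρ + μ₂ * a) * ‖e‖ ^ 2
        + 2 * (e ⬝ᵥ (P * (1 - E * C)) *ᵥ Δ)
        + 2 * (μ₂ * b - μ₁) * ⟪Δ, e⟫ - 2 * μ₂ * ‖Δ‖ ^ 2 < 0)
    (h2 : ∀ v : Fin n → ℝ, v ≠ 0 →
      v ⬝ᵥ (P * N * C + Cᵀ * Nᵀ * P) *ᵥ v < 0) :
    ∀ e : EuclideanSpace ℝ (Fin n), e ≠ 0 →
      ∀ Δ : EuclideanSpace ℝ (Fin n),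
        ⟪Δ, e⟫ ≤ ρ * ‖e‖ ^ 2 → ‖Δ‖ ^ 2 ≤ a * ‖e‖ ^ 2 + b * ⟪Δ, e⟫ →
        e ⬝ᵥ (P * G + Gᵀ * P) *ᵥ e
          + ((C *ᵥ e) ⬝ᵥ θ *ᵥ (C *ᵥ e)) * (e ⬝ᵥ (P * N * C + Cᵀ * Nᵀ * P) *ᵥ e)
          + 2 * (e ⬝ᵥ (P * (1 - E * C)) *ᵥ Δ) < 0 := by
  intro e he Δ hosl hqib
  have hlmi := h1 e Δ fun h => he h.1
  have he' : e.ofLp ≠ 0 := fun h => he (by ext i; simp [h])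
  have hθe : 0 ≤ (C *ᵥ e) ⬝ᵥ θ *ᵥ (C *ᵥ e) := by
    simpa using hθ.dotProduct_mulVec_nonneg (C *ᵥ e)
  have hcubic := mul_nonpos_of_nonneg_of_nonpos hθe (h2 e he').le
  have hosl' := mul_le_mul_of_nonneg_left hosl hμ₁.le
  have hqib' := mul_le_mul_of_nonneg_left hqib hμ₂.le
  linarith
end
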